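/- arXiv:2108.12379 — 2 statements merged into one kernel-verified Lean document; each statement's English description precedes it below -/
import Mathlib

section
/- Let ⪯ be a strongly artinian preorder on a monoid H and s an integer ≥ 2 such that, for every x ∈ H that is neither a ⪯-unit nor a ⪯-quark, there exist k with 2 ≤ k ≤ s and ⪯-non-units y₁, …, y_k ∈ H with x = y₁⋯y_k, yᵢ ⪯ x for each i, and hgt(y₁) + ⋯ + hgt(y_k) ≤ hgt(x) + k − 2. Then the preorder ⪯ is artinian and every ⪯-irreducible of degree s is a ⪯-quark. -/
/-- `u` is a `⪯`-unit of the monoid `H`: `u ⪯ 1` and `1 ⪯ u`. -/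
def IsPreUnit {H : Type*} [Monoid H] (le : H → H → Prop) (u : H) : Prop :=
  le u 1 ∧ le 1 u

/-- The strict relation associated with the preorder `le`: `x ≺ y`. -/
def PreLt {H : Type*} [Monoid H] (le : H → H → Prop) (x y : H) : Prop :=
  le x y ∧ ¬ le y x

/-- `a` is a `⪯`-irreducible of degree `s`: a `⪯`-non-unit which, for no `k` with
`2 ≤ k ≤ s`, can be written as a product of `k` `⪯`-non-units each strictly smaller
than `a` with respect to `⪯`. -/
def IsPreIrred {H : Type*} [Monoid H] (le : H → H → Prop) (s : ℕ) (a : H) : Prop :=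
  ¬ IsPreUnit le a ∧
    ∀ l : List H, 2 ≤ l.length → l.length ≤ s →
      (∀ b ∈ l, ¬ IsPreUnit le b ∧ PreLt le b a) → l.prod ≠ a

/-- `a` is a `⪯`-quark: a `⪯`-non-unit with no `⪯`-non-unit strictly below it. -/
def IsPreQuark {H : Type*} [Monoid H] (le : H → H → Prop) (a : H) : Prop :=
  ¬ IsPreUnit le a ∧ ∀ b, ¬ IsPreUnit le b → ¬ PreLt le b a

/-- The `⪯`-height of `x`: the supremum in `ℕ∞` (with `sSup ∅ = 0`) of the set of
integers `n ≥ 1` for which there is a sequence `x₁, …, xₙ` of `⪯`-non-units with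
`x₁ = x` and `x_{k+1} ≺ x_k` for `1 ≤ k ≤ n-1`. -/
noncomputable def preHgt {H : Type*} [Monoid H] (le : H → H → Prop) (x : H) : ℕ∞ :=
  sSup ((fun n : ℕ => (n : ℕ∞)) ''
    {n : ℕ | 1 ≤ n ∧ ∃ f : ℕ → H, f 1 = x ∧
      (∀ i, 1 ≤ i → i ≤ n → ¬ IsPreUnit le (f i)) ∧
      (∀ i, 1 ≤ i → i < n → PreLt le (f (i + 1)) (f i))})

theorem natCast_le_preHgt {H : Type*} [Monoid H] {le : H → H → Prop} {n : ℕ} (hn : 1 ≤ n)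
    (f : ℕ → H) (hf : ∀ i, 1 ≤ i → i ≤ n → ¬ IsPreUnit le (f i))
    (hlt : ∀ i, 1 ≤ i → i < n → PreLt le (f (i + 1)) (f i)) :
    (n : ℕ∞) ≤ preHgt le (f 1) :=
  le_sSup ⟨n, ⟨hn, f, rfl, hf, hlt⟩, rfl⟩

theorem one_le_preHgt {H : Type*} [Monoid H] {le : H → H → Prop} {x : H}
    (hx : ¬ IsPreUnit le x) : 1 ≤ preHgt le x := by
  simpa using natCast_le_preHgt (n := 1) le_rfl (fun _ => x) (fun _ _ _ => hx)
    (fun i hi hi' => absurd hi (by omega))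

theorem preHgt_mono {H : Type*} [Monoid H] {le : H → H → Prop}
    (htrans : ∀ x y z, le x y → le y z → le x z) {x y : H}
    (hy : ¬ IsPreUnit le y) (hxy : le x y) : preHgt le x ≤ preHgt le y := by
  refine sSup_le ?_
  rintro _ ⟨n, ⟨hn, f, rfl, hf, hlt⟩, rfl⟩
  have key := natCast_le_preHgt (le := le) hn (Function.update f 1 y) ?_ ?_
  · simpa using key
  · intro i hi hin
    rcases eq_or_ne i 1 with rfl | h
    · simpa using hy
    · simpa [h] using hf i hi hin
  · intro i hi hin
    have hi1 : i + 1 ≠ 1 := by omega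
    rcases eq_or_ne i 1 with rfl | h
    · obtain ⟨h₁, h₂⟩ := hlt 1 le_rfl hin
      rw [Function.update_of_ne hi1, Function.update_self]
      exact ⟨htrans _ _ _ h₁ hxy, fun h => h₂ (htrans _ _ _ hxy h)⟩
    · rw [Function.update_of_ne hi1, Function.update_of_ne h]
      exact hlt i hi hin

theorem preHgt_eq_top_of_strictly_decreasing {H : Type*} [Monoid H] {le : H → H → Prop}
    (f : ℕ → H) (hf : ∀ i, ¬ IsPreUnit le (f i))
    (hlt : ∀ i, PreLt le (f (i + 1)) (f i)) : preHgt le (f 1) = ⊤ := by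
  refine ENat.eq_top_iff_forall_ge.2 fun n => ?_
  calc (n : ℕ∞) ≤ ((n + 1 : ℕ) : ℕ∞) := by exact_mod_cast n.le_succ
    _ ≤ _ := natCast_le_preHgt (by omega) f (fun i _ _ => hf i) (fun i _ _ => hlt i)

theorem le_of_strictly_decreasing {H : Type*} [Monoid H] {le : H → H → Prop}
    (hrefl : ∀ x, le x x) (htrans : ∀ x y z, le x y → le y z → le x z)
    {f : ℕ → H} (hlt : ∀ i, PreLt le (f (i + 1)) (f i)) (m k : ℕ) :
    le (f (m + k)) (f m) := by
  induction k with
  | zero => exact hrefl _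
  | succ k ih => exact htrans _ _ _ (hlt (m + k)).1 ih

theorem List.add_length_le_sum_map_add_one {α : Type*} (g : α → ℕ∞) (l : List α)
    (hg : ∀ x ∈ l, 1 ≤ g x) {y : α} (hy : y ∈ l) :
    g y + l.length ≤ (l.map g).sum + 1 := by
  obtain ⟨l₁, l₂, rfl⟩ := List.append_of_mem hy
  have h : ∀ l : List α, (∀ x ∈ l, 1 ≤ g x) → (l.length : ℕ∞) ≤ (l.map g).sum := by
    intro l hl
    simpa using List.card_nsmul_le_sum (l.map g) 1 (by simpa using hl)
  have h₁ := h l₁ fun x hx => hg x (by simp [hx])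
  have h₂ := h l₂ fun x hx => hg x (by simp [hx])
  simp only [List.length_append, List.length_cons, List.map_append, List.map_cons,
    List.sum_append, List.sum_cons, Nat.cast_add, Nat.cast_one]
  calc g y + (l₁.length + (l₂.length + 1)) = l₁.length + (g y + l₂.length) + 1 := by ring
    _ ≤ _ := by gcongr

/-- Let `⪯` be a strongly artinian preorder on a monoid `H` and `s ≥ 2`
such that every element that is neither a `⪯`-unit nor a `⪯`-quark factors as a product
of `k` `⪯`-non-units (`2 ≤ k ≤ s`), each `⪯ x`, whose heights sum to at most
`hgt(x) + k - 2`. Then `⪯` is artinian and every `⪯`-irreducible of degree `s` is a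
`⪯`-quark. -/
theorem abstract_factorization_strongly_artinian {H : Type*} [Monoid H]
    (le : H → H → Prop)
    (hrefl : ∀ x, le x x) (htrans : ∀ x y z, le x y → le y z → le x z)
    (s : ℕ) (hs : 2 ≤ s)
    (hstrong : ∀ x : H, preHgt le x ≠ ⊤)
    (hfact : ∀ x : H, ¬ IsPreUnit le x → ¬ IsPreQuark le x →
      ∃ l : List H, 2 ≤ l.length ∧ l.length ≤ s ∧
        (∀ y ∈ l, ¬ IsPreUnit le y ∧ le y x) ∧ l.prod = x ∧
        (l.map (preHgt le)).sum ≤ preHgt le x + (l.length : ℕ∞) - 2) :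
    (¬ ∃ f : ℕ → H, ∀ k, PreLt le (f (k + 1)) (f k)) ∧
      ∀ a : H, IsPreIrred le s a → IsPreQuark le a := by
  constructor
  · rintro ⟨f, hlt⟩
    have hle := le_of_strictly_decreasing hrefl htrans hlt
    obtain ⟨m, hm⟩ : ∃ m, ∀ i, ¬ IsPreUnit le (f (m + i)) := by
      by_cases h : ∃ m, IsPreUnit le (f m)
      · obtain ⟨m, hm⟩ := h
        refine ⟨m + 1, fun i hi => (hlt m).2 ?_⟩
        exact htrans _ _ _ hm.1 (htrans _ _ _ hi.2 (hle (m + 1) i))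
      · exact ⟨0, fun i hi => h ⟨_, hi⟩⟩
    exact hstrong _ (preHgt_eq_top_of_strictly_decreasing (fun i => f (m + i)) hm
      fun i => hlt (m + i))
  · rintro a ⟨ha, hirr⟩
    by_contra hq
    obtain ⟨l, hl2, hls, hl, hprod, hsum⟩ := hfact a ha hq
    refine hirr l hl2 hls (fun b hb => ⟨(hl b hb).1, (hl b hb).2, fun hab => ?_⟩) hprod
    have hbound := l.add_length_le_sum_map_add_one (preHgt le)
      (fun x hx => one_le_preHgt (hl x hx).1) hb
    have hmono := preHgt_mono htrans (hl b hb).1 hab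
    have htotal : preHgt le a + l.length ≤ preHgt le a + l.length - 2 + 1 :=
      (add_le_add_left hmono _).trans (hbound.trans (add_le_add_left hsum 1))
    obtain ⟨n, hn⟩ := ENat.ne_top_iff_exists.1 (hstrong a)
    rw [← hn] at htotal
    have : n + l.length ≤ n + l.length - 2 + 1 := by exact_mod_cast htotal
    omega
end

section
/- Let R be a right Rickart ring and H the monoid consisting of the left zero divisors of R together with 1, equipped with the rFix-preorder. An element a ∈ R is an rFix-quark of H if and only if a is a coprimitive idempotent of R. -/
/-- The right annihilator `rann(a) = {x : a*x = 0}` of `a`, as a right ideal of `R`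
(i.e. a submodule of `R` viewed as a right module over itself, encoded as a module
over `Rᵐᵒᵖ`). -/
def rAnn (R : Type*) [Ring R] (a : R) : Submodule Rᵐᵒᵖ R where
  carrier := {x | a * x = 0}
  add_mem' := by
    intro x y hx hy
    simp only [Set.mem_setOf_eq] at *
    rw [mul_add, hx, hy, add_zero]
  zero_mem' := by simp
  smul_mem' := by
    intro c x hx
    simp only [Set.mem_setOf_eq] at *
    show a * (x * c.unop) = 0
    rw [← mul_assoc, hx, zero_mul]

/-- `rfix(a) = rann(1-a) = {x : a*x = x}`, as a right ideal of `R`. -/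
def rFix (R : Type*) [Ring R] (a : R) : Submodule Rᵐᵒᵖ R where
  carrier := {x | a * x = x}
  add_mem' := by
    intro x y hx hy
    simp only [Set.mem_setOf_eq] at *
    rw [mul_add, hx, hy]
  zero_mem' := by simp
  smul_mem' := by
    intro c x hx
    simp only [Set.mem_setOf_eq] at *
    show a * (x * c.unop) = x * c.unop
    rw [← mul_assoc, hx]

/-- The principal right ideal `aR = {a*y : y ∈ R}`. -/
def rPrin (R : Type*) [Ring R] (a : R) : Submodule Rᵐᵒᵖ R where
  carrier := {x | ∃ y, x = a * y}
  add_mem' := by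
    rintro x y ⟨u, rfl⟩ ⟨v, rfl⟩
    exact ⟨u + v, (mul_add a u v).symm⟩
  zero_mem' := ⟨0, (mul_zero a).symm⟩
  smul_mem' := by
    rintro c x ⟨u, rfl⟩
    exact ⟨u * c.unop, by show a * u * c.unop = a * (u * c.unop); rw [mul_assoc]⟩

/-- A right ideal `N` of `R` is indecomposable if it is nonzero and is not the
(internal) direct sum of two nonzero right ideals. -/
def IndecRId {R : Type*} [Ring R] (N : Submodule Rᵐᵒᵖ R) : Prop :=
  N ≠ ⊥ ∧ ¬ ∃ N₁ N₂ : Submodule Rᵐᵒᵖ R, N₁ ≠ ⊥ ∧ N₂ ≠ ⊥ ∧ N₁ ⊓ N₂ = ⊥ ∧ N₁ ⊔ N₂ = N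

/-- Membership in the monoid `H` of left zero divisors of `R` together with `1`. -/
def IsLeftZDOrOne (R : Type*) [Ring R] (a : R) : Prop :=
  (∃ y : R, y ≠ 0 ∧ a * y = 0) ∨ a = 1

/-- `a` is a unit for the rFix-preorder (`a ⪯ 1` and `1 ⪯ a`, where `x ⪯ y` iff
`rfix(y) ⊆ rfix(x)`). -/
def IsRFixUnit (R : Type*) [Ring R] (a : R) : Prop :=
  rFix R 1 ≤ rFix R a ∧ rFix R a ≤ rFix R 1

theorem mem_rAnn {R : Type*} [Ring R] {a x : R} : x ∈ rAnn R a ↔ a * x = 0 := Iff.rfl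

theorem mem_rFix {R : Type*} [Ring R] {a x : R} : x ∈ rFix R a ↔ a * x = x := Iff.rfl

theorem mul_mem_rightIdeal {R : Type*} [Ring R] {N : Submodule Rᵐᵒᵖ R} {x : R} (hx : x ∈ N)
    (r : R) : x * r ∈ N :=
  N.smul_mem (MulOpposite.op r) hx

theorem rFix_eq_rAnn_one_sub {R : Type*} [Ring R] (a : R) : rFix R a = rAnn R (1 - a) := by
  ext x
  rw [mem_rAnn, mem_rFix, sub_mul, one_mul, sub_eq_zero, eq_comm]

theorem rFix_eq_top_iff {R : Type*} [Ring R] {a : R} : rFix R a = ⊤ ↔ a = 1 := by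
  constructor
  · intro h
    have h1 : (1 : R) ∈ rFix R a := h ▸ Submodule.mem_top
    simpa [mem_rFix] using h1
  · rintro rfl
    exact eq_top_iff.2 fun x _ => one_mul x

theorem isRFixUnit_iff {R : Type*} [Ring R] {a : R} : IsRFixUnit R a ↔ a = 1 := by
  rw [IsRFixUnit, rFix_eq_top_iff.2 rfl, top_le_iff, rFix_eq_top_iff]
  exact and_iff_left le_top

/-- If a right ideal is an internal direct sum `N₁ ⊕ N₂` and `e₁ + e₂` acts on it as the identity
from the left, with `eᵢ ∈ Nᵢ`, then `e₁` is the projection onto `N₁`. -/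
theorem projection_of_direct_sum {R : Type*} [Ring R] {N₁ N₂ : Submodule Rᵐᵒᵖ R}
    (hinf : N₁ ⊓ N₂ = ⊥) {e₁ e₂ x : R} (h₁ : e₁ ∈ N₁) (h₂ : e₂ ∈ N₂) (hx : x ∈ N₁)
    (he : (e₁ + e₂) * x = x) : e₁ * x = x ∧ e₂ * x = 0 := by
  have h : e₂ * x ∈ N₁ ⊓ N₂ := by
    refine ⟨?_, mul_mem_rightIdeal h₂ x⟩
    have : e₂ * x = x - e₁ * x := by rw [eq_sub_iff_add_eq', ← add_mul, he]
    rw [this]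
    exact N₁.sub_mem hx (mul_mem_rightIdeal h₁ x)
  rw [hinf, Submodule.mem_bot] at h
  rw [add_mul, h, add_zero] at he
  exact ⟨he, h⟩

/-- A right annihilator that is a direct summand contains an element acting on it as the
identity from the left. -/
theorem exists_left_identity_rAnn {R : Type*} [Ring R] {a : R} {J : Submodule Rᵐᵒᵖ R}
    (hinf : rAnn R a ⊓ J = ⊥) (hsup : rAnn R a ⊔ J = ⊤) :
    ∃ f, a * f = 0 ∧ ∀ x, a * x = 0 → f * x = x := by
  obtain ⟨f, hf, g, hg, hfg⟩ := Submodule.mem_sup.1 (hsup ▸ Submodule.mem_top (x := (1 : R)))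
  exact ⟨f, hf, fun x hx => (projection_of_direct_sum hinf hf hg hx (by rw [hfg, one_mul])).1⟩

theorem isCompl_rAnn_rFix {R : Type*} [Ring R] {a : R} (ha : a * a = a) :
    IsCompl (rAnn R a) (rFix R a) := by
  refine ⟨disjoint_iff.2 ?_, codisjoint_iff.2 ?_⟩
  · rw [eq_bot_iff]
    rintro x ⟨h0, h1⟩
    exact (Submodule.mem_bot _).2 ((mem_rFix.1 h1).symm.trans h0)
  · rw [eq_top_iff]
    intro x _
    refine Submodule.mem_sup.2 ⟨x - a * x, ?_, a * x, ?_, sub_add_cancel _ _⟩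
    · rw [mem_rAnn, mul_sub, ← mul_assoc, ha, sub_self]
    · rw [mem_rFix, ← mul_assoc, ha]

/-- In a modular lattice, if `n` has a complement `c` that is properly contained in a
complemented element `b ≠ ⊤`, then `n` splits nontrivially. -/
theorem IsCompl.exists_split_of_lt {α : Type*} [Lattice α] [BoundedOrder α] [IsModularLattice α]
    {n c b j : α} (hnc : IsCompl n c) (hbj : IsCompl b j) (hcb : c < b) (hb : b ≠ ⊤) :
    ∃ n₁ n₂ : α, n₁ ≠ ⊥ ∧ n₂ ≠ ⊥ ∧ n₁ ⊓ n₂ = ⊥ ∧ n₁ ⊔ n₂ = n := by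
  have hsplit : c ⊔ n ⊓ b = b := by
    rw [← sup_inf_assoc_of_le n hcb.le, sup_comm, hnc.sup_eq_top, top_inf_eq]
  have hsup : n ⊓ b ⊔ n ⊓ (c ⊔ j) = n := by
    rw [inf_comm n (c ⊔ j), ← sup_inf_assoc_of_le (c ⊔ j) (inf_le_left : n ⊓ b ≤ n),
      ← sup_assoc, sup_comm (n ⊓ b) c, hsplit, hbj.sup_eq_top, top_inf_eq]
  refine ⟨n ⊓ b, n ⊓ (c ⊔ j), fun h => ?_, fun h => ?_, ?_, hsup⟩
  · rw [h, sup_bot_eq] at hsplit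
    exact hcb.ne hsplit
  · rw [h, sup_bot_eq, inf_eq_left] at hsup
    exact hb (top_le_iff.1 (hnc.sup_eq_top ▸ sup_le hsup hcb.le))
  · have hc : (c ⊔ j) ⊓ b = c := by
      rw [sup_inf_assoc_of_le j hcb.le, inf_comm, hbj.inf_eq_bot, sup_bot_eq]
    rw [inf_inf_inf_comm, inf_idem, inf_comm b, hc, hnc.inf_eq_bot]

/-- If `rfix(a)` is maximal among the `rfix(b)` with `1 ≠ b ∈ H`, then `rann(g) ⊆ rfix(a)` for
every nonzero idempotent `g` with `rfix(a) ⊆ rann(g)`. -/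
theorem rAnn_le_rFix_of_maximal {R : Type*} [Ring R] {a g : R}
    (hmax : ¬ ∃ b : R, IsLeftZDOrOne R b ∧ ¬ IsRFixUnit R b ∧ rFix R a < rFix R b)
    (hg : g * g = g) (hg0 : g ≠ 0) (hle : rFix R a ≤ rAnn R g) : rAnn R g ≤ rFix R a := by
  have hfix : rFix R (1 - g) = rAnn R g := by rw [rFix_eq_rAnn_one_sub, sub_sub_cancel]
  by_contra hnot
  refine hmax ⟨1 - g, Or.inl ⟨g, hg0, ?_⟩, ?_, ?_⟩
  · rw [sub_mul, one_mul, hg, sub_self]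
  · rw [isRFixUnit_iff, sub_eq_self]
    exact hg0
  · rw [hfix]
    exact lt_of_le_not_ge hle hnot

theorem mul_self_eq_of_rFix_maximal {R : Type*} [Ring R] {a f y : R}
    (hmax : ¬ ∃ b : R, IsLeftZDOrOne R b ∧ ¬ IsRFixUnit R b ∧ rFix R a < rFix R b)
    (hy0 : y ≠ 0) (hy : a * y = 0) (haf : a * f = 0) (hf : ∀ x, a * x = 0 → f * x = x) :
    a * a = a := by
  have hff : f * f = f := hf f haf
  have hgf : f * (1 - a) * f = f := by
    rw [mul_assoc, sub_mul, one_mul, haf, sub_zero, hff]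
  have hgg : f * (1 - a) * (f * (1 - a)) = f * (1 - a) := by rw [← mul_assoc, hgf]
  have hg0 : f * (1 - a) ≠ 0 := by
    intro h
    rw [h, zero_mul] at hgf
    exact hy0 (by rw [← hf y hy, ← hgf, zero_mul])
  have hle : rFix R a ≤ rAnn R (f * (1 - a)) := by
    intro x hx
    rw [mem_rAnn, mul_assoc, sub_mul, one_mul, mem_rFix.1 hx, sub_self, mul_zero]
  have hmem : a * (1 - f * (1 - a)) = 1 - f * (1 - a) := by
    refine rAnn_le_rFix_of_maximal hmax hgg hg0 hle ?_
    rw [mem_rAnn, mul_sub, mul_one, hgg, sub_self]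
  rw [mul_sub, mul_one, ← mul_assoc, haf, zero_mul, sub_zero] at hmem
  calc a * a = a * (1 - f * (1 - a)) := by rw [← hmem]
    _ = a := by rw [mul_sub, mul_one, ← mul_assoc, haf, zero_mul, sub_zero]

theorem indecRId_rAnn_of_rFix_maximal {R : Type*} [Ring R] {a : R}
    (hmax : ¬ ∃ b : R, IsLeftZDOrOne R b ∧ ¬ IsRFixUnit R b ∧ rFix R a < rFix R b)
    (haa : a * a = a) (ha1 : a ≠ 1) : IndecRId (rAnn R a) := by
  have hmem : 1 - a ∈ rAnn R a := by rw [mem_rAnn, mul_sub, mul_one, haa, sub_self]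
  refine ⟨fun h => ?_, ?_⟩
  · rw [h, Submodule.mem_bot, sub_eq_zero] at hmem
    exact ha1 hmem.symm
  rintro ⟨N₁, N₂, h₁, h₂, hinf, hsup⟩
  obtain ⟨e₁, he₁, e₂, he₂, he⟩ := Submodule.mem_sup.1 (hsup ▸ hmem)
  have hid : ∀ x ∈ rAnn R a, (e₁ + e₂) * x = x := fun x hx => by
    rw [he, sub_mul, one_mul, mem_rAnn.1 hx, sub_zero]
  have hN₁ : ∀ x ∈ N₁, e₁ * x = x := fun x hx =>
    (projection_of_direct_sum hinf he₁ he₂ hx (hid x (hsup ▸ Submodule.mem_sup_left hx))).1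
  have hN₂ : ∀ x ∈ N₂, e₁ * x = 0 := fun x hx =>
    (projection_of_direct_sum (inf_comm N₁ N₂ ▸ hinf) he₂ he₁ hx
      (add_comm e₁ e₂ ▸ hid x (hsup ▸ Submodule.mem_sup_right hx))).2
  have he₁0 : e₁ ≠ 0 := by
    rintro rfl
    exact h₁ ((Submodule.eq_bot_iff _).2 fun x hx => by rw [← hN₁ x hx, zero_mul])
  have hle : rFix R a ≤ rAnn R e₁ := by
    intro x hx
    rw [rFix_eq_rAnn_one_sub, mem_rAnn, ← he, add_mul] at hx
    have hx' : e₁ * x ∈ N₁ ⊓ N₂ := by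
      refine ⟨mul_mem_rightIdeal he₁ x, ?_⟩
      rw [eq_neg_of_add_eq_zero_left hx]
      exact N₂.neg_mem (mul_mem_rightIdeal he₂ x)
    rwa [hinf, Submodule.mem_bot] at hx'
  refine h₂ ((Submodule.eq_bot_iff _).2 fun x hx => ?_)
  have hfix : a * x = x := rAnn_le_rFix_of_maximal hmax (hN₁ e₁ he₁) he₁0 hle (hN₂ x hx)
  have hann : a * x = 0 := mem_rAnn.1 (hsup ▸ Submodule.mem_sup_right hx)
  exact hfix.symm.trans hann

/-- Let `R` be a right Rickart ring and `H` the monoid of left zero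
divisors of `R` together with `1`, with the rFix-preorder. An element `a ∈ R` is an
rFix-quark of `H` if and only if `a` is a coprimitive idempotent of `R`. -/
theorem rFix_quark_iff_coprimitive_idempotent
    {R : Type*} [Ring R] [Nontrivial R]
    (hrick : ∀ x : R, ∃ J : Submodule Rᵐᵒᵖ R, rAnn R x ⊓ J = ⊥ ∧ rAnn R x ⊔ J = ⊤)
    (a : R) :
    (IsLeftZDOrOne R a ∧ ¬ IsRFixUnit R a ∧
      ¬ ∃ b : R, IsLeftZDOrOne R b ∧ ¬ IsRFixUnit R b ∧ rFix R a < rFix R b) ↔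
    (a * a = a ∧ IndecRId (rAnn R a)) := by
  constructor
  · rintro ⟨hzd, hnu, hmax⟩
    rw [isRFixUnit_iff] at hnu
    obtain ⟨y, hy0, hy⟩ := hzd.resolve_right hnu
    obtain ⟨J, hinf, hsup⟩ := hrick a
    obtain ⟨f, haf, hf⟩ := exists_left_identity_rAnn hinf hsup
    have haa := mul_self_eq_of_rFix_maximal hmax hy0 hy haf hf
    exact ⟨haa, indecRId_rAnn_of_rFix_maximal hmax haa hnu⟩
  · rintro ⟨haa, hne, hind⟩
    obtain ⟨y, hy, hy0⟩ := Submodule.exists_mem_ne_zero_of_ne_bot hne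
    refine ⟨Or.inl ⟨y, hy0, hy⟩, ?_, ?_⟩
    · rw [isRFixUnit_iff]
      rintro rfl
      exact hy0 ((one_mul y).symm.trans hy)
    · rintro ⟨b, -, hb, hlt⟩
      rw [isRFixUnit_iff, ← rFix_eq_top_iff] at hb
      obtain ⟨J, hinf, hsup⟩ := hrick (1 - b)
      rw [← rFix_eq_rAnn_one_sub] at hinf hsup
      exact hind ((isCompl_rAnn_rFix haa).exists_split_of_lt
        ⟨disjoint_iff.2 hinf, codisjoint_iff.2 hsup⟩ hlt hb)
end
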